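/- Every quantum minor det_q(I, J), for subsets I, J ⊆ {1, …, n} of equal cardinality, is an element of the dual canonical basis B* of O_q(M(n)). -/

import Mathlib

open scoped TensorProduct

set_option synthInstance.maxHeartbeats 1000000
set_option maxHeartbeats 1000000

noncomputable section

/-- The base field `K = ℚ(q)`. -/
abbrev Kq : Type := RatFunc ℚ

/-- The indeterminate `q ∈ ℚ(q)`. -/
noncomputable def qq : Kq := RatFunc.X

/-- Matrices with nonnegative integer entries. -/
abbrev Mat (n : ℕ) := Matrix (Fin n) (Fin n) ℕ

/-- The defining relations of the quantum matrix algebra `O_q(M(n))`. -/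
inductive OqRel (n : ℕ) :
    FreeAlgebra Kq (Fin n × Fin n) → FreeAlgebra Kq (Fin n × Fin n) → Prop
  | rel_row {i j k : Fin n} (h : j < k) :
      OqRel n (FreeAlgebra.ι Kq (i, j) * FreeAlgebra.ι Kq (i, k))
        ((qq ^ 2) • (FreeAlgebra.ι Kq (i, k) * FreeAlgebra.ι Kq (i, j)))
  | rel_col {i k j : Fin n} (h : i < k) :
      OqRel n (FreeAlgebra.ι Kq (i, j) * FreeAlgebra.ι Kq (k, j))
        ((qq ^ 2) • (FreeAlgebra.ι Kq (k, j) * FreeAlgebra.ι Kq (i, j)))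
  | rel_anti {i j s t : Fin n} (h1 : s < i) (h2 : j < t) :
      OqRel n (FreeAlgebra.ι Kq (i, j) * FreeAlgebra.ι Kq (s, t))
        (FreeAlgebra.ι Kq (s, t) * FreeAlgebra.ι Kq (i, j))
  | rel_diag {i j s t : Fin n} (h1 : i < s) (h2 : j < t) :
      OqRel n (FreeAlgebra.ι Kq (i, j) * FreeAlgebra.ι Kq (s, t))
        (FreeAlgebra.ι Kq (s, t) * FreeAlgebra.ι Kq (i, j)
          + (qq ^ 2 - qq⁻¹ ^ 2) • (FreeAlgebra.ι Kq (i, t) * FreeAlgebra.ι Kq (s, j)))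

/-- The quantum matrix algebra `O_q(M(n))`. -/
abbrev Oq (n : ℕ) := RingQuot (OqRel n)

/-- The generator `x_{ij}` of `O_q(M(n))`. -/
noncomputable def xgen (n : ℕ) (i j : Fin n) : Oq n :=
  RingQuot.mkAlgHom Kq (OqRel n) (FreeAlgebra.ι Kq (i, j))

/-- The lexicographically ordered monomial `x^A`. -/
noncomputable def xMon (n : ℕ) (A : Mat n) : Oq n :=
  ((List.finRange n).map fun i =>
    ((List.finRange n).map fun j => xgen n i j ^ A i j).prod).prod
/-- The exponent appearing in `E(A)` and `D(A)`. -/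
def eExp (n : ℕ) (A : Mat n) : ℕ :=
  ∑ i, ∑ j, ∑ k ∈ Finset.univ.filter (fun k => k < j), (A i j * A i k + A j i * A k i)

/-- The modified monomial `x(A) = D(A) x^A`. -/
noncomputable def xMod (n : ℕ) (A : Mat n) : Oq n := (qq ^ (-(eExp n A : ℤ))) • xMon n A

/-- `matStep M M'` : `M'` is obtained from `M` by a single 2×2 submatrix transformation. -/
def matStep (n : ℕ) (M M' : Mat n) : Prop :=
  ∃ i s j t : Fin n, i < s ∧ j < t ∧ 1 ≤ M i j ∧ 1 ≤ M s t ∧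
    M' i j = M i j - 1 ∧ M' s t = M s t - 1 ∧ M' i t = M i t + 1 ∧ M' s j = M s j + 1 ∧
    ∀ u v : Fin n,
      ¬((u = i ∧ v = j) ∨ (u = s ∧ v = t) ∨ (u = i ∧ v = t) ∨ (u = s ∧ v = j)) →
        M' u v = M u v

/-- `matLT B A` : `B < A`, i.e. `B` is obtained from `A` by a nonempty sequence of
2×2 submatrix transformations. -/
def matLT (n : ℕ) (B A : Mat n) : Prop := Relation.TransGen (matStep n) A B

/-- Membership in `ℤ[q] ⊆ ℚ(q)`. -/
def inZq (c : Kq) : Prop := c ∈ Subring.closure ({qq} : Set Kq)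

/-- Membership in `qℤ[q] ⊆ ℚ(q)`. -/
def inQZq (c : Kq) : Prop := ∃ d : Kq, inZq d ∧ c = qq * d

/-- Membership in `ℤ[q, q⁻¹] ⊆ ℚ(q)`. -/
def inZLaurent (c : Kq) : Prop := c ∈ Subring.closure ({qq, qq⁻¹} : Set Kq)

/-- `bar` is the bar involution: a `ℚ`-algebra anti-automorphism fixing the `x_{ij}`
and semilinear with respect to `q ↦ q⁻¹`. -/
def IsBar (n : ℕ) (bar : Oq n → Oq n) : Prop :=
  Function.Bijective bar ∧
  (∀ a b : Oq n, bar (a + b) = bar a + bar b) ∧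
  (∀ (r : ℚ) (a : Oq n), bar ((r : Kq) • a) = (r : Kq) • bar a) ∧
  (∀ a b : Oq n, bar (a * b) = bar b * bar a) ∧
  bar 1 = 1 ∧
  (∀ i j, bar (xgen n i j) = xgen n i j) ∧
  (∀ a : Oq n, bar (qq • a) = qq⁻¹ • bar a)

/-- Membership in the `ℤ[q]`-lattice `L* = ⊕_A ℤ[q]·x(A)`. -/
def memLstar (n : ℕ) (v : Oq n) : Prop :=
  ∃ (F : Finset (Mat n)) (h : Mat n → Kq),
    (∀ A ∈ F, inZq (h A)) ∧ v = ∑ A ∈ F, h A • xMod n A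

/-- `b` is the dual canonical basis of `O_q(M(n))` relative to the bar involution `bar`:
each `b A` is bar-invariant, is `x(A)` plus a `qℤ[q]`-combination of `x(B)` with `B < A`,
and the family is a `ℤ[q]`-basis of `L*`. -/
def IsDCB (n : ℕ) (bar : Oq n → Oq n) (b : Mat n → Oq n) : Prop :=
  (∀ A, bar (b A) = b A) ∧
  (∀ A, ∃ (F : Finset (Mat n)) (h : Mat n → Kq),
      (∀ B ∈ F, matLT n B A ∧ inQZq (h B)) ∧
      b A = xMod n A + ∑ B ∈ F, h B • xMod n B) ∧
  (∀ v, memLstar n v → ∃ (F : Finset (Mat n)) (h : Mat n → Kq),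
      (∀ A ∈ F, inZq (h A)) ∧ v = ∑ A ∈ F, h A • b A) ∧
  (∀ (F : Finset (Mat n)) (h : Mat n → Kq), (∀ A ∈ F, inZq (h A)) →
      ∑ A ∈ F, h A • b A = 0 → ∀ A ∈ F, h A = 0)
/-- The number of inversions (the length) of a permutation. -/
def invCount {m : ℕ} (σ : Equiv.Perm (Fin m)) : ℕ :=
  ((Finset.univ : Finset (Fin m × Fin m)).filter fun p => p.1 < p.2 ∧ σ p.2 < σ p.1).card

/-- The quantum minor `det_q(I, J)` (defined to be `0` when `|I| ≠ |J|`). -/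
noncomputable def qMinor (n : ℕ) (I J : Finset (Fin n)) : Oq n :=
  if h : J.card = I.card then
    ∑ σ : Equiv.Perm (Fin I.card),
      ((-(qq ^ 2)) ^ invCount σ) •
        ((List.finRange I.card).map fun r =>
          xgen n ((I.orderIsoOfFin rfl r : {x // x ∈ I}) : Fin n)
            ((J.orderIsoOfFin h (σ r) : {x // x ∈ J}) : Fin n)).prod
  else 0

/-- The quantum determinant `det_q ∈ O_q(M(n))`. -/
noncomputable def qDet (n : ℕ) : Oq n :=
  ∑ σ : Equiv.Perm (Fin n),
    ((-(qq ^ 2)) ^ invCount σ) • ((List.finRange n).map fun i => xgen n i (σ i)).prod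

/-- The relation imposing `det_q = 1`. -/
def SLRel (n : ℕ) : Oq n → Oq n → Prop := fun a b => a = qDet n ∧ b = 1

/-- The quantized function algebra `O_q(SL(n)) = O_q(M(n))/⟨det_q - 1⟩`. -/
abbrev OqSL (n : ℕ) := RingQuot (SLRel n)

/-- The canonical projection `T : O_q(M(n)) → O_q(SL(n))`. -/
noncomputable def Tmap (n : ℕ) : Oq n →ₐ[Kq] OqSL n := RingQuot.mkAlgHom Kq (SLRel n)

/-- The image of the generator `x_{ij}` in `O_q(SL(n))`. -/
noncomputable def Xbar (n : ℕ) (i j : Fin n) : OqSL n := Tmap n (xgen n i j)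

section QuantumMinors

open Polynomial

lemma qq_ne_zero : qq ≠ 0 := RatFunc.X_ne_zero

lemma aeval_qq_injective : Function.Injective (aeval qq : ℤ[X] →ₐ[ℤ] Kq) := by
  have h : ∀ p : ℤ[X], aeval qq p = algebraMap ℚ[X] Kq (p.map (Int.castRingHom ℚ)) := fun p => by
    induction p using Polynomial.induction_on' with
    | add p r hp hr => simp [hp, hr]
    | monomial k z => simp [← C_mul_X_pow_eq_monomial, qq]
  intro p r hpr
  rw [h, h] at hpr
  exact map_injective _ Int.cast_injective (RatFunc.algebraMap_injective ℚ hpr)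

lemma inZq_iff (c : Kq) : inZq c ↔ ∃ p : ℤ[X], aeval qq p = c := by
  constructor
  · intro h
    induction h using Subring.closure_induction with
    | mem x hx => exact ⟨X, by rw [aeval_X, Set.mem_singleton_iff.1 hx]⟩
    | zero => exact ⟨0, map_zero _⟩
    | one => exact ⟨1, map_one _⟩
    | add x y _ _ hx hy =>
      obtain ⟨⟨p, rfl⟩, r, rfl⟩ := And.intro hx hy
      exact ⟨p + r, map_add _ _ _⟩
    | neg x _ hx =>
      obtain ⟨p, rfl⟩ := hx
      exact ⟨-p, map_neg _ _⟩
    | mul x y _ _ hx hy =>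
      obtain ⟨⟨p, rfl⟩, r, rfl⟩ := And.intro hx hy
      exact ⟨p * r, map_mul _ _ _⟩
  · rintro ⟨p, rfl⟩
    have hq : qq ∈ Subring.closure ({qq} : Set Kq) := Subring.subset_closure rfl
    induction p using Polynomial.induction_on' with
    | add p r hp hr =>
      rw [map_add]
      exact Subring.add_mem _ hp hr
    | monomial k z =>
      rw [aeval_monomial, eq_intCast]
      exact Subring.mul_mem _ (intCast_mem _ z) (Subring.pow_mem _ hq k)

lemma pow_succ_mul_aeval_inv (N : ℕ) (p : ℤ[X]) (hp : p.natDegree ≤ N) :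
    qq ^ (N + 1) * (qq⁻¹ * aeval qq⁻¹ p) = aeval qq (reflect N p) := by
  have hu : Invertible (qq⁻¹) := invertibleOfNonzero (inv_ne_zero qq_ne_zero)
  have h := eval₂_reflect_mul_pow (algebraMap ℤ Kq) qq⁻¹ N p hp
  rw [invOf_eq_inv, inv_inv] at h
  rw [aeval_def, aeval_def, ← h, pow_succ, inv_pow]
  have := qq_ne_zero
  field_simp

lemma eq_zero_of_X_pow_mul_eq_reflect (N : ℕ) (p : ℤ[X]) (hp : p.natDegree ≤ N)
    (h : X ^ (N + 2) * p = reflect N p) : p = 0 := by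
  ext k
  by_contra hk
  have h2 := congrArg (fun r => coeff r (k + (N + 2))) h
  simp only [coeff_X_pow_mul] at h2
  rw [coeff_reflect, revAt_eq_self_of_lt (by omega),
    coeff_eq_zero_of_natDegree_lt (by omega : p.natDegree < k + (N + 2))] at h2
  exact hk h2

section Bar

variable {n : ℕ} {bar : Oq n → Oq n}

lemma IsBar.map_zero (hbar : IsBar n bar) : bar 0 = 0 := by
  have h := hbar.2.1 0 0
  rw [add_zero] at h
  exact left_eq_add.1 h

lemma IsBar.map_sum (hbar : IsBar n bar) {ι : Type*} (s : Finset ι) (f : ι → Oq n) :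
    bar (∑ i ∈ s, f i) = ∑ i ∈ s, bar (f i) :=
  _root_.map_sum (⟨⟨bar, hbar.map_zero⟩, hbar.2.1⟩ : Oq n →+ Oq n) f s

lemma IsBar.map_aeval_smul (hbar : IsBar n bar) (p : ℤ[X]) (a : Oq n) :
    bar (aeval qq p • a) = aeval qq⁻¹ p • bar a := by
  induction p using Polynomial.induction_on' with
  | add p r hp hr => rw [_root_.map_add, _root_.map_add, add_smul, add_smul, hbar.2.1, hp, hr]
  | monomial k z =>
    have hpow : ∀ (k : ℕ) (a : Oq n), bar (qq ^ k • a) = qq⁻¹ ^ k • bar a := by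
      intro k
      induction k with
      | zero => intro a; simp
      | succ k ih => intro a; rw [pow_succ, mul_smul, ih, hbar.2.2.2.2.2.2, smul_smul, pow_succ]
    have hz := hbar.2.2.1 (z : ℚ) (qq ^ k • a)
    rw [aeval_monomial, aeval_monomial, eq_intCast, mul_smul, mul_smul, ← hpow]
    simpa using hz

lemma IsBar.map_list_prod (hbar : IsBar n bar) (l : List (Oq n)) (hl : ∀ a ∈ l, bar a = a) :
    bar l.prod = l.reverse.prod := by
  induction l with
  | nil => simpa using hbar.2.2.2.2.1
  | cons a l ih =>
    rw [List.prod_cons, hbar.2.2.2.1, ih fun c hc => hl c (List.mem_cons_of_mem _ hc),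
      hl a List.mem_cons_self, List.reverse_cons, List.prod_append, List.prod_singleton]

/-- A bar-invariant element congruent to `b A` modulo `qL*` equals `b A`. -/
lemma IsDCB.eq_of_bar_eq (hbar : IsBar n bar) {b : Mat n → Oq n} (hb : IsDCB n bar b)
    {A : Mat n} {v u : Oq n} (hv : bar v = v) (hu : memLstar n u) (hvu : v = b A + qq • u) :
    v = b A := by
  obtain ⟨hbA, -, hspan, hind⟩ := hb
  obtain ⟨F, d, hd, rfl⟩ := hspan u hu
  have hd' : ∀ B, ∃ p : ℤ[X], B ∈ F → aeval qq p = d B := fun B => by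
    by_cases hB : B ∈ F
    · obtain ⟨p, hp⟩ := (inZq_iff _).1 (hd B hB)
      exact ⟨p, fun _ => hp⟩
    · exact ⟨0, fun h => absurd h hB⟩
  choose p hp using hd'
  have hsum : ∑ B ∈ F, d B • b B = ∑ B ∈ F, aeval qq (p B) • b B :=
    Finset.sum_congr rfl fun B hB => by rw [hp B hB]
  rw [hsum] at hvu
  have hw : qq⁻¹ • ∑ B ∈ F, aeval qq⁻¹ (p B) • b B = qq • ∑ B ∈ F, aeval qq (p B) • b B := by
    have h := hv
    rw [hvu, hbar.2.1, hbA, hbar.2.2.2.2.2.2, hbar.map_sum] at h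
    simpa only [hbar.map_aeval_smul, hbA, add_right_inj] using h
  let N := F.sup fun B => (p B).natDegree
  have hN : ∀ B ∈ F, (p B).natDegree ≤ N := fun B hB =>
    Finset.le_sup (f := fun B => (p B).natDegree) hB
  have hzero : ∑ B ∈ F, aeval qq (X ^ (N + 2) * p B - reflect N (p B)) • b B = 0 := by
    have h := congrArg (fun x => qq ^ (N + 1) • x) hw
    simp only [Finset.smul_sum, smul_smul] at h
    rw [← sub_eq_zero, ← neg_eq_zero, neg_sub, ← Finset.sum_sub_distrib] at h
    rw [← h]
    refine Finset.sum_congr rfl fun B hB => ?_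
    rw [← sub_smul, pow_succ_mul_aeval_inv N _ (hN B hB), _root_.map_sub,
      _root_.map_mul, _root_.map_pow, aeval_X]
    ring_nf
  have hp0 : ∀ B ∈ F, p B = 0 := fun B hB => by
    have h := hind F _ (fun B _ => (inZq_iff _).2 ⟨_, rfl⟩) hzero B hB
    have h' := (map_eq_zero_iff _ aeval_qq_injective).1 h
    exact eq_zero_of_X_pow_mul_eq_reflect N _ (hN B hB) (sub_eq_zero.1 h')
  rw [hvu, Finset.sum_eq_zero fun B hB => by rw [hp0 B hB, _root_.map_zero, zero_smul],
    smul_zero, add_zero]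

end Bar

lemma memLstar_of_mem_span {n : ℕ} {v : Oq n}
    (hv : v ∈ Submodule.span (Subring.closure ({qq} : Set Kq)) (Set.range (xMod n))) :
    memLstar n v := by
  obtain ⟨c, rfl⟩ := Finsupp.mem_span_range_iff_exists_finsupp.1 hv
  exact ⟨c.support, fun A => c A, fun A _ => (c A).2, rfl⟩

lemma smul_xMod_mem_span {n : ℕ} {c : Kq} (hc : inZq c) (A : Mat n) :
    c • xMod n A ∈ Submodule.span (Subring.closure ({qq} : Set Kq)) (Set.range (xMod n)) :=
  Submodule.smul_mem _ (⟨c, hc⟩ : Subring.closure ({qq} : Set Kq))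
    (Submodule.subset_span ⟨A, rfl⟩)

section Permutations

variable {m : ℕ}

lemma invCount_mul_swap (σ : Equiv.Perm (Fin m)) {k l : Fin m} (hkl : (l : ℕ) = k + 1)
    (h : σ k < σ l) : invCount (σ * Equiv.swap k l) = invCount σ + 1 := by
  have hne : k < l := Fin.lt_def.2 (by omega)
  let s := Equiv.swap k l
  let e : Fin m × Fin m ≃ Fin m × Fin m := s.prodCongr s
  have hset : ((Finset.univ : Finset (Fin m × Fin m)).filter
      fun p => p.1 < p.2 ∧ (σ * s) p.2 < (σ * s) p.1) =
      insert (k, l) (((Finset.univ : Finset (Fin m × Fin m)).filter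
        fun p => p.1 < p.2 ∧ σ p.2 < σ p.1).map e.symm.toEmbedding) := by
    ext ⟨a, c⟩
    simp only [Finset.mem_filter, Finset.mem_univ, true_and, Finset.mem_insert, Prod.mk.injEq,
      Finset.mem_map_equiv, Equiv.symm_symm, e, Equiv.prodCongr_apply, Prod.map_apply,
      Equiv.Perm.mul_apply, s, Equiv.swap_apply_def]
    split_ifs <;> subst_vars <;> simp_all <;> grind
  rw [invCount, hset, Finset.card_insert_of_notMem, Finset.card_map]
  · rfl
  · simp [e, s, hne.le]

lemma invCount_mul_rev (σ : Equiv.Perm (Fin m)) :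
    invCount (σ * Fin.revPerm) + invCount σ = invCount (Fin.revPerm : Equiv.Perm (Fin m)) := by
  have h1 : invCount (σ * Fin.revPerm) =
      ((Finset.univ : Finset (Fin m × Fin m)).filter fun p => p.1 < p.2 ∧ σ p.1 < σ p.2).card := by
    refine Finset.card_equiv ((Equiv.prodComm _ _).trans (Fin.revPerm.prodCongr Fin.revPerm)) ?_
    rintro ⟨a, c⟩
    simp
  rw [h1, invCount, invCount, ← Finset.card_union_of_disjoint]
  · congr 1
    ext ⟨a, c⟩
    simp only [Finset.mem_union, Finset.mem_filter, Finset.mem_univ, true_and,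
      Fin.revPerm_apply, Fin.rev_lt_rev]
    constructor
    · rintro (h | h) <;> exact ⟨h.1, h.1⟩
    · rintro ⟨h, -⟩
      have : σ a ≠ σ c := σ.injective.ne h.ne
      rcases lt_or_gt_of_ne this with h' | h'
      · exact Or.inl ⟨h, h'⟩
      · exact Or.inr ⟨h, h'⟩
  · rw [Finset.disjoint_filter]
    rintro x - h h'
    exact lt_asymm h.2 h'.2

lemma exists_descent {τ : Equiv.Perm (Fin m)} (hτ : τ ≠ 1) :
    ∃ k l : Fin m, (l : ℕ) = k + 1 ∧ τ l < τ k := by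
  by_contra! h
  apply hτ
  have hmono : StrictMono τ := by
    cases m with
    | zero => exact fun a => a.elim0
    | succ m =>
      refine Fin.strictMono_iff_lt_succ.2 fun i => lt_of_le_of_ne (h _ _ (by simp)) ?_
      exact τ.injective.ne (Fin.castSucc_lt_succ).ne
  have h1 := Subsingleton.elim (hmono.orderIsoOfSurjective τ τ.surjective) (OrderIso.refl _)
  ext i
  exact congrArg (fun e : Fin m ≃o Fin m => (e i : ℕ)) h1

lemma invCount_pos {σ : Equiv.Perm (Fin m)} (hσ : σ ≠ 1) : 0 < invCount σ := by
  obtain ⟨k, l, hkl, hlt⟩ := exists_descent hσ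
  exact Finset.card_pos.2 ⟨(k, l), by simpa using ⟨Fin.lt_def.2 (by omega), hlt⟩⟩

lemma invCount_one : invCount (1 : Equiv.Perm (Fin m)) = 0 := by
  simp only [invCount, Equiv.Perm.one_apply, Finset.card_eq_zero]
  exact Finset.filter_false_of_mem fun p _ h => lt_asymm h.1 h.2

lemma exists_finRange_eq_append (k l : Fin m) (hkl : (l : ℕ) = k + 1) :
    ∃ l₁ l₂ : List (Fin m), List.finRange m = l₁ ++ k :: l :: l₂ ∧
      (∀ a ∈ l₁, a ≠ k ∧ a ≠ l) ∧ ∀ a ∈ l₂, a ≠ k ∧ a ≠ l := by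
  have hlen : (l : ℕ) < (List.finRange m).length := by simp
  have h : List.finRange m =
      (List.finRange m).take k ++ k :: l :: (List.finRange m).drop (l + 1) := by
    conv_lhs => rw [← List.take_append_drop k (List.finRange m)]
    rw [List.drop_eq_getElem_cons (by omega), List.drop_eq_getElem_cons (by omega)]
    simp [← hkl]
  refine ⟨_, _, h, ?_⟩
  have hnd := List.nodup_finRange m
  rw [h] at hnd
  simp only [List.nodup_append, List.nodup_cons] at hnd
  grind

end Permutations

section Straightening

variable {R : Type*} [Ring R] [Algebra Kq R] {m : ℕ}

/-- The row-permuted quantum determinant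
`∑ σ, (-q²)^ℓ(σ) y_{τ(1)σ(1)} ⋯ y_{τ(m)σ(m)}` of a square array `y`. -/
def rowPermDet (y : Fin m → Fin m → R) (τ : Equiv.Perm (Fin m)) : R :=
  ∑ σ : Equiv.Perm (Fin m),
    ((-(qq ^ 2)) ^ invCount σ) • ((List.finRange m).map fun r => y (τ r) (σ r)).prod

lemma sum_perm_eq_sum_ascent {M : Type*} [AddCommMonoid M] {k l : Fin m} (hkl : k ≠ l)
    (f : Equiv.Perm (Fin m) → M) :
    ∑ σ, f σ = ∑ σ with σ k < σ l, (f σ + f (σ * Equiv.swap k l)) := by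
  rw [Finset.sum_add_distrib, ← Finset.sum_filter_add_sum_filter_not Finset.univ
    (fun σ : Equiv.Perm (Fin m) => σ k < σ l)]
  congr 1
  refine (Finset.sum_equiv (Equiv.mulRight (Equiv.swap k l)) ?_ ?_).symm
  · intro σ
    simpa using (lt_iff_le_and_ne.trans (and_iff_left (σ.injective.ne hkl)))
  · simp

lemma rowPermDet_mul_swap (y : Fin m → Fin m → R)
    (hanti : ∀ a c i j, a < c → i < j → y c i * y a j = y a j * y c i)
    (hdiag : ∀ a c i j, a < c → i < j →
      y a i * y c j = y c j * y a i + (qq ^ 2 - qq⁻¹ ^ 2) • (y a j * y c i))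
    (τ : Equiv.Perm (Fin m)) {k l : Fin m} (hkl : (l : ℕ) = k + 1) (hτ : τ k < τ l) :
    rowPermDet y (τ * Equiv.swap k l) = (-(qq ^ 2)) • rowPermDet y τ := by
  have hne : k ≠ l := Fin.ne_of_lt (Fin.lt_def.2 (by omega))
  obtain ⟨l₁, l₂, hl, h₁, h₂⟩ := exists_finRange_eq_append k l hkl
  rw [rowPermDet, rowPermDet, sum_perm_eq_sum_ascent hne, sum_perm_eq_sum_ascent hne,
    Finset.smul_sum]
  refine Finset.sum_congr rfl fun σ hσ => ?_
  have hσ' : σ k < σ l := (Finset.mem_filter.1 hσ).2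
  have hq := qq_ne_zero
  have hfactor : ∀ τ' σ' : Equiv.Perm (Fin m),
      (∀ a, a ≠ k ∧ a ≠ l → τ' a = τ a ∧ σ' a = σ a) →
      ((List.finRange m).map fun r => y (τ' r) (σ' r)).prod =
        (l₁.map fun r => y (τ r) (σ r)).prod * (y (τ' k) (σ' k) * y (τ' l) (σ' l)) *
          (l₂.map fun r => y (τ r) (σ r)).prod := by
    intro τ' σ' h
    have hmap : ∀ l' : List (Fin m), (∀ a ∈ l', a ≠ k ∧ a ≠ l) →
        (l'.map fun r => y (τ' r) (σ' r)) = l'.map fun r => y (τ r) (σ r) := fun l' h' =>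
      List.map_congr_left fun a ha => by rw [(h a (h' a ha)).1, (h a (h' a ha)).2]
    rw [hl, List.map_append, List.map_cons, List.map_cons, List.prod_append, List.prod_cons,
      List.prod_cons, hmap _ h₁, hmap _ h₂]
    simp only [mul_assoc]
  have hoff : ∀ (ρ : Equiv.Perm (Fin m)) (a : Fin m), a ≠ k ∧ a ≠ l →
      (ρ * Equiv.swap k l) a = ρ a := fun ρ a h => by
    rw [Equiv.Perm.mul_apply, Equiv.swap_apply_of_ne_of_ne h.1 h.2]
  rw [hfactor τ σ fun a _ => ⟨rfl, rfl⟩,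
    hfactor _ σ fun a h => ⟨hoff τ a h, rfl⟩, hfactor τ _ fun a h => ⟨rfl, hoff σ a h⟩,
    hfactor _ _ fun a h => ⟨hoff τ a h, hoff σ a h⟩, invCount_mul_swap σ hkl hσ']
  simp only [Equiv.Perm.mul_apply, Equiv.swap_apply_left, Equiv.swap_apply_right]
  have hcore : y (τ l) (σ k) * y (τ k) (σ l) + (-(qq ^ 2)) • (y (τ l) (σ l) * y (τ k) (σ k)) =
      (-(qq ^ 2)) • (y (τ k) (σ k) * y (τ l) (σ l) +
        (-(qq ^ 2)) • (y (τ k) (σ l) * y (τ l) (σ k))) := by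
    have hc : qq ^ 2 * (qq ^ 2 - qq⁻¹ ^ 2) = qq ^ 4 - 1 := by field_simp
    have h := congrArg (fun x => (qq ^ 2) • x) (hdiag _ _ _ _ hτ hσ')
    simp only [smul_add, smul_smul, hc] at h
    have h4 : -(qq ^ 2) * -(qq ^ 2) = qq ^ 4 := by ring
    rw [hanti _ _ _ _ hτ hσ', smul_add, smul_smul, h4, neg_smul, neg_smul, h, sub_smul, one_smul]
    abel
  have h := congrArg (fun x => ((-(qq ^ 2)) ^ invCount σ) •
    ((l₁.map fun r => y (τ r) (σ r)).prod * x * (l₂.map fun r => y (τ r) (σ r)).prod)) hcore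
  simp only [mul_add, add_mul, mul_smul_comm, smul_mul_assoc, smul_add, smul_smul,
    pow_succ _ (invCount σ), mul_comm, mul_assoc] at h ⊢
  exact h

lemma rowPermDet_eq_smul (y : Fin m → Fin m → R)
    (hanti : ∀ a c i j, a < c → i < j → y c i * y a j = y a j * y c i)
    (hdiag : ∀ a c i j, a < c → i < j →
      y a i * y c j = y c j * y a i + (qq ^ 2 - qq⁻¹ ^ 2) • (y a j * y c i))
    (τ : Equiv.Perm (Fin m)) :
    rowPermDet y τ = ((-(qq ^ 2)) ^ invCount τ) • rowPermDet y 1 := by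
  induction hN : invCount τ using Nat.strong_induction_on generalizing τ with
  | _ N ih =>
    by_cases hτ : τ = 1
    · rw [← hN, hτ, invCount_one, pow_zero, one_smul]
    · obtain ⟨k, l, hkl, hlt⟩ := exists_descent hτ
      have hasc : (τ * Equiv.swap k l) k < (τ * Equiv.swap k l) l := by simpa using hlt
      have hττ : τ * Equiv.swap k l * Equiv.swap k l = τ := by
        rw [mul_assoc, Equiv.swap_mul_self, mul_one]
      have hinv := invCount_mul_swap _ hkl hasc
      have hdet := rowPermDet_mul_swap y hanti hdiag _ hkl hasc
      rw [hττ] at hinv hdet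
      rw [hdet, ih _ (by omega) _ rfl, smul_smul, ← pow_succ', ← hinv, hN]

end Straightening

lemma IsBar.map_rowPermDet {n m : ℕ} {bar : Oq n → Oq n} (hbar : IsBar n bar)
    (y : Fin m → Fin m → Oq n)
    (hanti : ∀ a c i j, a < c → i < j → y c i * y a j = y a j * y c i)
    (hdiag : ∀ a c i j, a < c → i < j →
      y a i * y c j = y c j * y a i + (qq ^ 2 - qq⁻¹ ^ 2) • (y a j * y c i))
    (hy : ∀ i j, bar (y i j) = y i j) :
    bar (rowPermDet y 1) = rowPermDet y 1 := by
  have hq := qq_ne_zero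
  have hsmul : ∀ (k : ℕ) (a : Oq n),
      bar ((-(qq ^ 2)) ^ k • a) = (-(qq⁻¹ ^ 2)) ^ k • bar a := fun k a => by
    have h := hbar.map_aeval_smul ((-(X ^ 2)) ^ k) a
    rwa [_root_.map_pow, _root_.map_neg, _root_.map_pow, aeval_X, _root_.map_pow, _root_.map_neg,
      _root_.map_pow, aeval_X] at h
  have hc : (-(qq ^ 2)) ^ invCount (Fin.revPerm : Equiv.Perm (Fin m)) ≠ 0 :=
    pow_ne_zero _ (neg_ne_zero.2 (pow_ne_zero _ hq))
  refine smul_right_injective _ hc ?_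
  change _ • bar (rowPermDet y 1) = _ • rowPermDet y 1
  rw [← rowPermDet_eq_smul y hanti hdiag, rowPermDet, rowPermDet, hbar.map_sum, Finset.smul_sum]
  conv_rhs => rw [← Equiv.sum_comp (Equiv.mulRight Fin.revPerm)]
  refine Finset.sum_congr rfl fun σ _ => ?_
  rw [hsmul, hbar.map_list_prod _ (by simp [hy]), ← List.map_reverse, List.finRange_reverse,
    List.map_map, smul_smul, ← invCount_mul_rev σ, pow_add, mul_assoc, ← mul_pow]
  have h1 : -(qq ^ 2) * -(qq⁻¹ ^ 2) = 1 := by field_simp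
  rw [h1, one_pow, mul_one]
  rfl

lemma exists_sum_eq_qq_smul {n : ℕ} {ι : Type*} (F : Finset ι) (c : ι → Kq) (A : ι → Mat n)
    (hc : ∀ i ∈ F, inQZq (c i)) :
    ∃ u ∈ Submodule.span (Subring.closure ({qq} : Set Kq)) (Set.range (xMod n)),
      ∑ i ∈ F, c i • xMod n (A i) = qq • u := by
  choose! d hd hcd using hc
  refine ⟨∑ i ∈ F, d i • xMod n (A i),
    Submodule.sum_mem _ fun i hi => smul_xMod_mem_span (hd i hi) _, ?_⟩
  rw [Finset.smul_sum]
  exact Finset.sum_congr rfl fun i hi => by rw [smul_smul, hcd i hi]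

section Generators

variable {n : ℕ}

lemma xgen_anti {i j s t : Fin n} (h1 : s < i) (h2 : j < t) :
    xgen n i j * xgen n s t = xgen n s t * xgen n i j := by
  simpa [xgen] using RingQuot.mkAlgHom_rel Kq (OqRel.rel_anti h1 h2)

lemma xgen_diag {i j s t : Fin n} (h1 : i < s) (h2 : j < t) :
    xgen n i j * xgen n s t =
      xgen n s t * xgen n i j + (qq ^ 2 - qq⁻¹ ^ 2) • (xgen n i t * xgen n s j) := by
  simpa only [xgen, map_mul, map_add, map_smul] using
    RingQuot.mkAlgHom_rel Kq (OqRel.rel_diag h1 h2)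

lemma list_prod_map_finRange_eq_of_orderEmb {M : Type*} [Monoid M] {m : ℕ} (e : Fin m ↪o Fin n)
    (f : Fin n → M) (hf : ∀ i, i ∉ Set.range e → f i = 1) :
    ((List.finRange n).map f).prod = ((List.finRange m).map fun r => f (e r)).prod := by
  classical
  have hfilter : (List.finRange m).map e =
      (List.finRange n).filter (fun i => i ∈ Set.range e) := by
    refine List.SortedLT.eq_of_mem_iff ?_ ?_ (by simp)
    · exact ((List.pairwise_map).2 ((List.pairwise_lt_finRange m).imp fun h =>
        e.lt_iff_lt.2 h)).sortedLT
    · exact ((List.pairwise_lt_finRange n).filter _).sortedLT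
  have hprod : ∀ l : List (Fin n),
      (l.map f).prod = ((l.filter fun i => i ∈ Set.range e).map f).prod := fun l => by
    induction l with
    | nil => rfl
    | cons a l ih =>
      by_cases ha : a ∈ Set.range e
      · rw [List.filter_cons_of_pos (by simpa using ha), List.map_cons, List.map_cons,
          List.prod_cons, List.prod_cons, ih]
      · rw [List.filter_cons_of_neg (by simpa using ha), List.map_cons, List.prod_cons, ih,
          hf a ha, one_mul]
  rw [hprod, ← hfilter, List.map_map]
  rfl

open Classical in
/-- The `0`-`1` matrix with ones at the positions `(e r, g r)`. -/
def placementMat {m : ℕ} (e g : Fin m → Fin n) : Mat n :=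
  fun u v => if ∃ r, e r = u ∧ g r = v then 1 else 0

lemma xMod_placementMat {m : ℕ} (e : Fin m ↪o Fin n) (g : Fin m → Fin n)
    (hg : Function.Injective g) :
    xMod n (placementMat e g) = ((List.finRange m).map fun r => xgen n (e r) (g r)).prod := by
  classical
  have hE : eExp n (placementMat e g) = 0 := by
    refine Finset.sum_eq_zero fun i _ => Finset.sum_eq_zero fun j _ =>
      Finset.sum_eq_zero fun k hk => ?_
    have hk' : k ≠ j := ((Finset.mem_filter.1 hk).2).ne
    simp only [placementMat]
    have h1 : ¬ ((∃ r, e r = i ∧ g r = j) ∧ ∃ r, e r = i ∧ g r = k) := by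
      rintro ⟨⟨r, hr, rfl⟩, r', hr', rfl⟩
      exact hk' (by rw [e.injective (hr.trans hr'.symm)])
    have h2 : ¬ ((∃ r, e r = j ∧ g r = i) ∧ ∃ r, e r = k ∧ g r = i) := by
      rintro ⟨⟨r, rfl, hr⟩, r', rfl, hr'⟩
      exact hk' (by rw [hg (hr.trans hr'.symm)])
    split_ifs <;> simp_all
  rw [xMod, hE, xMon, Nat.cast_zero, neg_zero, zpow_zero, one_smul,
    list_prod_map_finRange_eq_of_orderEmb e]
  · congr 1
    refine List.map_congr_left fun r _ => ?_
    have hrow : ∀ j, placementMat e g (e r) j = if j = g r then 1 else 0 := fun j => by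
      simp [placementMat, eq_comm]
    have hone := list_prod_map_finRange_eq_of_orderEmb (m := 1)
      (OrderEmbedding.ofStrictMono (fun _ => g r) (Subsingleton.strictMono _))
      (fun j => xgen n (e r) j ^ placementMat e g (e r) j) fun j hj => by
        rw [hrow, if_neg fun h => hj ⟨0, h.symm⟩, pow_zero]
    rw [hone]
    simp [hrow]
  · intro i hi
    refine List.prod_eq_one fun x hx => ?_
    obtain ⟨j, -, rfl⟩ := List.mem_map.1 hx
    rw [placementMat, if_neg, pow_zero]
    rintro ⟨r, hr, -⟩
    exact hi ⟨r, hr⟩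

end Generators

end QuantumMinors

/-- Every quantum minor `det_q(I, J)` (for `I, J ⊆ {1,…,n}` of equal
cardinality) is an element of the dual canonical basis `B*` of `O_q(M(n))`. -/
theorem quantum_minors_in_dual_canonical_basis (n : ℕ) (bar : Oq n → Oq n)
    (hbar : IsBar n bar) (b : Mat n → Oq n) (hb : IsDCB n bar b)
    (I J : Finset (Fin n)) (hIJ : J.card = I.card) :
    qMinor n I J ∈ Set.range b := by
  classical
  let e := I.orderEmbOfFin rfl
  let f := J.orderEmbOfFin hIJ
  let y : Fin I.card → Fin I.card → Oq n := fun r c => xgen n (e r) (f c)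
  let P : Equiv.Perm (Fin I.card) → Mat n := fun σ => placementMat e (f ∘ σ)
  have hdet : qMinor n I J = rowPermDet y 1 := by
    rw [qMinor, dif_pos hIJ]
    rfl
  have hinv : bar (qMinor n I J) = qMinor n I J := by
    rw [hdet]
    exact hbar.map_rowPermDet y
      (fun a c i j h1 h2 => xgen_anti (e.lt_iff_lt.2 h1) (f.lt_iff_lt.2 h2))
      (fun a c i j h1 h2 => xgen_diag (e.lt_iff_lt.2 h1) (f.lt_iff_lt.2 h2))
      fun i j => hbar.2.2.2.2.2.1 _ _
  have hexp : qMinor n I J = ∑ σ, ((-(qq ^ 2)) ^ invCount σ) • xMod n (P σ) := by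
    rw [hdet, rowPermDet]
    refine Finset.sum_congr rfl fun σ _ => ?_
    rw [xMod_placementMat e _ (f.injective.comp σ.injective)]
    rfl
  obtain ⟨u₁, hu₁, h₁⟩ := exists_sum_eq_qq_smul (Finset.univ.erase 1)
    (fun σ => (-(qq ^ 2)) ^ invCount σ) P fun σ hσ => by
      obtain ⟨k, hk⟩ := Nat.exists_eq_add_one.2 (invCount_pos (Finset.ne_of_mem_erase hσ))
      refine ⟨-qq * (-(qq ^ 2)) ^ k, ?_, by rw [hk]; ring⟩
      exact (inZq_iff _).2 ⟨-Polynomial.X * (-(Polynomial.X ^ 2)) ^ k, by simp⟩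
  obtain ⟨F, h, hF, hbP⟩ := hb.2.1 (P 1)
  obtain ⟨u₂, hu₂, h₂⟩ := exists_sum_eq_qq_smul F h id fun B hB => (hF B hB).2
  refine ⟨P 1, (hb.eq_of_bar_eq hbar hinv
    (memLstar_of_mem_span (Submodule.sub_mem _ hu₁ hu₂)) ?_).symm⟩
  simp only [id] at h₂
  rw [hexp, ← Finset.add_sum_erase _ _ (Finset.mem_univ 1), h₁, hbP, h₂, invCount_one, pow_zero,
    one_smul, smul_sub]
  abel
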